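/- arXiv:1801.03442 — 3 statements merged into one kernel-verified Lean document; each statement's English description precedes it below -/
import Mathlib

section
/- Let n ≥ 1 be an integer, α ∈ ℝ, let e ∈ ℝⁿ be a unit vector, let θ̃ ∈ S^{n−1}, and set t = ⟨e, θ̃⟩. For s̃ > 0 define y(s̃) = (sinh(α)·cosh(s̃) + cosh(α)·sinh(s̃)·t)·e + sinh(s̃)·(θ̃ − t·e) ∈ ℝⁿ (this is the spatial part of M_{α,e}(cosh(s̃), sinh(s̃)·θ̃)). Then y(s̃) ≠ 0 for all sufficiently large s̃, and lim_{s̃→∞} y(s̃)/|y(s̃)| = Φ_{α,e}^∞(θ̃). -/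
open scoped RealInnerProductSpace
open Filter

/-- The boundary action at infinity `Φ_{α,e}^∞` of the hyperbolic boost `M_{α,e}`
(Section 3.4). -/
noncomputable def PhiInf {n : ℕ} (α : ℝ) (e : EuclideanSpace ℝ (Fin n))
    (θ : EuclideanSpace ℝ (Fin n)) : EuclideanSpace ℝ (Fin n) :=
  (Real.cosh α + Real.sinh α * ⟪e, θ⟫)⁻¹ •
    ((Real.sinh α + Real.cosh α * ⟪e, θ⟫) • e + (θ - ⟪e, θ⟫ • e))

/-- The hyperbolic isometry `M_{α,e}` acts on the sphere at infinity by `Φ_{α,e}^∞`: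
with `t = ⟨e, θ̃⟩` and
`y(s̃) = (sinh α cosh s̃ + cosh α sinh s̃ t) e + sinh s̃ (θ̃ − t e)`
(the spatial part of `M_{α,e}(cosh s̃, sinh s̃ θ̃)`), one has `y(s̃) ≠ 0` for all large `s̃`
and `y(s̃)/|y(s̃)| → Φ_{α,e}^∞(θ̃)` as `s̃ → ∞`. -/
theorem Mmap_boundary_action (n : ℕ) (hn : 1 ≤ n) (α : ℝ)
    (e : EuclideanSpace ℝ (Fin n)) (he : ‖e‖ = 1)
    (θt : EuclideanSpace ℝ (Fin n))
    (hθt : θt ∈ Metric.sphere (0 : EuclideanSpace ℝ (Fin n)) 1)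
    (y : ℝ → EuclideanSpace ℝ (Fin n))
    (hy : ∀ s : ℝ, y s =
      (Real.sinh α * Real.cosh s + Real.cosh α * Real.sinh s * ⟪e, θt⟫) • e +
        Real.sinh s • (θt - ⟪e, θt⟫ • e)) :
    (∀ᶠ s in atTop, y s ≠ 0) ∧
    Tendsto (fun s => ‖y s‖⁻¹ • y s) atTop (nhds (PhiInf α e θt)) := by
  have hθ : ‖θt‖ = 1 := by simpa using hθt
  have htabs : |⟪e, θt⟫| ≤ 1 := by
    have := abs_real_inner_le_norm e θt
    rwa [he, hθ, one_mul] at this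
  obtain ⟨ht1, ht2⟩ := abs_le.mp htabs
  have hee : ⟪e, e⟫ = (1 : ℝ) := by rw [real_inner_self_eq_norm_sq, he]; norm_num
  have hθθ : ⟪θt, θt⟫ = (1 : ℝ) := by rw [real_inner_self_eq_norm_sq, hθ]; norm_num
  have hcomm : ⟪θt, e⟫ = ⟪e, θt⟫ := real_inner_comm _ _
  have htanh : Tendsto Real.tanh atTop (nhds 1) := by
    have h1 : Tendsto (fun s : ℝ => Real.exp (-(2 * s))) atTop (nhds 0) :=
      Real.tendsto_exp_neg_atTop_nhds_zero.comp
        (tendsto_id.const_mul_atTop (by norm_num : (0 : ℝ) < 2))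
    have h2 : Tendsto (fun s : ℝ => (1 - Real.exp (-(2 * s))) / (1 + Real.exp (-(2 * s))))
        atTop (nhds ((1 - 0) / (1 + 0))) :=
      (tendsto_const_nhds.sub h1).div (tendsto_const_nhds.add h1) (by norm_num)
    have h3 : Real.tanh = fun s : ℝ =>
        (1 - Real.exp (-(2 * s))) / (1 + Real.exp (-(2 * s))) := by
      funext s
      have hx : Real.exp (-(2 * s)) = Real.exp (-s) * Real.exp (-s) := by
        rw [← Real.exp_add]; ring_nf
      have hm : Real.exp s * Real.exp (-s) = 1 := by rw [← Real.exp_add]; simp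
      have p1 := Real.exp_pos s
      have p2 := Real.exp_pos (-s)
      rw [Real.tanh_eq_sinh_div_cosh, Real.sinh_eq, Real.cosh_eq, hx]
      rw [div_eq_div_iff (by positivity) (by positivity)]
      linear_combination (Real.exp (-s)) * hm
    rw [h3]
    simpa using h2
  generalize ht : ⟪e, θt⟫ = t at *
  have hcs : Real.cosh α ^ 2 = Real.sinh α ^ 2 + 1 := Real.cosh_sq α
  have hDpos : 0 < Real.cosh α + Real.sinh α * t := by
    have hc := Real.cosh_pos α
    have : |Real.sinh α * t| < Real.cosh α := by
      apply abs_lt_of_sq_lt_sq _ hc.le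
      nlinarith [mul_nonneg (sq_nonneg (Real.sinh α)) (by nlinarith : 0 ≤ 1 - t ^ 2)]
    linarith [(abs_lt.mp this).1]
  set v := (Real.sinh α + Real.cosh α * t) • e + (θt - t • e) with hv
  have hvn : ‖v‖ = Real.cosh α + Real.sinh α * t := by
    have : ‖v‖ ^ 2 = (Real.cosh α + Real.sinh α * t) ^ 2 := by
      rw [← real_inner_self_eq_norm_sq, hv]
      simp only [inner_add_left, inner_add_right, inner_sub_left, inner_sub_right,
        real_inner_smul_left, real_inner_smul_right, hee, hθθ, hcomm, ht]
      linear_combination (t ^ 2 - 1) * hcs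
    exact (sq_eq_sq₀ (norm_nonneg _) hDpos.le).mp this
  set w : ℝ → EuclideanSpace ℝ (Fin n) := fun s =>
    (Real.sinh α + Real.cosh α * Real.tanh s * t) • e + Real.tanh s • (θt - t • e) with hw
  have hyw : ∀ s, y s = Real.cosh s • w s := by
    intro s
    have h : Real.sinh s = Real.cosh s * Real.tanh s := by
      rw [Real.tanh_eq_sinh_div_cosh, mul_div_cancel₀ _ (Real.cosh_pos s).ne']
    rw [hy, h, hw]
    module
  have hwv : Tendsto w atTop (nhds v) := by
    have : Tendsto w atTop (nhds ((Real.sinh α + Real.cosh α * 1 * t) • e +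
        (1 : ℝ) • (θt - t • e))) :=
      ((tendsto_const_nhds.add ((htanh.const_mul _).mul_const _)).smul_const _).add
        (htanh.smul_const _)
    simpa [hv] using this
  have hv0 : v ≠ 0 := by
    rw [← norm_pos_iff, hvn]; exact hDpos
  refine ⟨?_, ?_⟩
  · filter_upwards [hwv.eventually_ne hv0] with s hs
    rw [hyw]
    exact smul_ne_zero (Real.cosh_pos s).ne' hs
  · have hP : PhiInf α e θt = ‖v‖⁻¹ • v := by
      rw [hvn, PhiInf, ht]
    rw [hP]
    have hF : (fun s => ‖y s‖⁻¹ • y s) = fun s => ‖w s‖⁻¹ • w s := by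
      funext s
      have hc := Real.cosh_pos s
      rw [hyw, norm_smul, Real.norm_of_nonneg hc.le, smul_smul, mul_inv]
      congr 1
      field_simp
    rw [hF]
    exact (hwv.norm.inv₀ (norm_ne_zero_iff.mpr hv0)).smul hwv
end

section
/- Let n ≥ 2 be an integer, α ∈ ℝ, and let e ∈ S^{n−1} ⊂ ℝⁿ. Then for every function F : S^{n−1} → ℝ integrable with respect to σ: ∫_{S^{n−1}} F(Φ_{α,e}^∞(θ̃))·(cosh(α) + sinh(α)·⟨e, θ̃⟩)^{−(n−1)} dσ(θ̃) = ∫_{S^{n−1}} F(θ) dσ(θ). Equivalently, the Jacobian of the conformal transformation Φ_{α,e}^∞ of the sphere at θ̃ equals (cosh(α) + sinh(α)·⟨e, θ̃⟩)^{−(n−1)}. -/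
open scoped RealInnerProductSpace
open MeasureTheory

open scoped NNReal ENNReal Topology
open Filter Set

theorem aux_comp_le {X : Type*} [MeasurableSpace X] (μ ν η : Measure X) (g : X → ℝ≥0)
    (hg : Measurable g) (m : ℕ) (hm : m ≠ 0)
    (h1 : ∀ A, MeasurableSet A → ∀ a : ℝ≥0, (∀ x ∈ A, g x ≤ a) → ν A ≤ (a : ℝ≥0∞) ^ m * μ A)
    (h2 : ∀ A, MeasurableSet A → ∀ a : ℝ≥0, (∀ x ∈ A, a ≤ g x) → (a : ℝ≥0∞) ^ m * μ A ≤ η A)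
    (s : Set X) (hs : MeasurableSet s) : ν s ≤ η s := by
  have key : ∀ t : ℝ≥0, 1 < t → ν s ≤ (t : ℝ≥0∞) ^ m * η s := by
    intro t ht
    have t0 : t ≠ 0 := (zero_lt_one.trans ht).ne'
    let f : X → ℝ≥0∞ := fun x => g x
    have hf : Measurable f := hg.coe_nnreal_ennreal
    have A : ν (s ∩ f ⁻¹' {0}) ≤ ((t : ℝ≥0∞) ^ m • η :) (s ∩ f ⁻¹' {0}) := by
      have := h1 (s ∩ f ⁻¹' {0}) (hs.inter (hf (measurableSet_singleton _))) 0 (by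
        rintro x ⟨-, hx⟩
        simpa [f] using hx)
      rw [ENNReal.coe_zero, zero_pow hm, zero_mul] at this
      exact this.trans zero_le
    have B : ν (s ∩ f ⁻¹' {∞}) ≤ ((t : ℝ≥0∞) ^ m • η :) (s ∩ f ⁻¹' {∞}) := by
      have : f ⁻¹' {∞} = ∅ := by ext x; simp [f]
      simp [this]
    have C : ∀ n : ℤ, ν (s ∩ f ⁻¹' Ico ((t : ℝ≥0∞) ^ n) ((t : ℝ≥0∞) ^ (n + 1))) ≤
        ((t : ℝ≥0∞) ^ m • η :) (s ∩ f ⁻¹' Ico ((t : ℝ≥0∞) ^ n) ((t : ℝ≥0∞) ^ (n + 1))) := by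
      intro n
      have M : MeasurableSet (s ∩ f ⁻¹' Ico ((t : ℝ≥0∞) ^ n) ((t : ℝ≥0∞) ^ (n + 1))) :=
        hs.inter (hf measurableSet_Ico)
      have u1 := h1 _ M (t ^ (n + 1)) (by
        rintro x ⟨-, -, hx⟩
        rw [← ENNReal.coe_zpow t0] at hx
        exact (ENNReal.coe_lt_coe.1 hx).le)
      have u2 := h2 _ M (t ^ n) (by
        rintro x ⟨-, hx, -⟩
        rw [← ENNReal.coe_zpow t0] at hx
        exact (ENNReal.coe_le_coe.1 hx))
      refine u1.trans ?_
      rw [Measure.smul_apply, smul_eq_mul]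
      refine le_trans (le_of_eq ?_) (mul_le_mul_right u2 _)
      rw [zpow_add₀ t0, zpow_one, ENNReal.coe_mul, mul_pow]
      ring
    calc ν s = _ := measure_eq_measure_preimage_add_measure_tsum_Ico_zpow ν hf hs ht
      _ ≤ _ := add_le_add (add_le_add A B) (ENNReal.tsum_le_tsum C)
      _ = _ := (measure_eq_measure_preimage_add_measure_tsum_Ico_zpow
            ((t : ℝ≥0∞) ^ m • η) hf hs ht).symm
  have T : Tendsto (fun t : ℝ≥0 => ((t : ℝ≥0∞) ^ m * η s : ℝ≥0∞)) (𝓝[>] 1)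
      (𝓝 ((1 : ℝ≥0∞) ^ m * η s)) := by
    refine ENNReal.Tendsto.mul_const ?_ ?_
    · exact ENNReal.Tendsto.pow (ENNReal.tendsto_coe.2 nhdsWithin_le_nhds)
    · simp
  simp only [one_pow, one_mul] at T
  refine ge_of_tendsto T ?_
  filter_upwards [self_mem_nhdsWithin] with t ht
  exact key t ht

theorem aux_comp_eq {X : Type*} [MeasurableSpace X] (μ ν : Measure X) (g : X → ℝ≥0)
    (hg : Measurable g) (m : ℕ) (hm : m ≠ 0)
    (h1 : ∀ A, MeasurableSet A → ∀ a : ℝ≥0, (∀ x ∈ A, g x ≤ a) → ν A ≤ (a : ℝ≥0∞) ^ m * μ A)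
    (h2 : ∀ A, MeasurableSet A → ∀ a : ℝ≥0, (∀ x ∈ A, a ≤ g x) → (a : ℝ≥0∞) ^ m * μ A ≤ ν A) :
    ν = μ.withDensity (fun x => ((g x ^ m : ℝ≥0) : ℝ≥0∞)) := by
  ext s hs
  refine le_antisymm (aux_comp_le μ _ _ g hg m hm h1 ?_ s hs)
    (aux_comp_le μ _ _ g hg m hm ?_ h2 s hs)
  · intro A hA a ha
    rw [withDensity_apply _ hA, ← setLIntegral_const]
    refine setLIntegral_mono' hA fun x hx => ?_
    rw [← ENNReal.coe_pow]
    exact ENNReal.coe_le_coe.2 (pow_le_pow_left' (ha x hx) m)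
  · intro A hA a ha
    rw [withDensity_apply _ hA, ← setLIntegral_const]
    refine setLIntegral_mono' hA fun x hx => ?_
    rw [← ENNReal.coe_pow]
    exact ENNReal.coe_le_coe.2 (pow_le_pow_left' (ha x hx) m)

section geom
variable {n : ℕ} (α : ℝ) {e x y : EuclideanSpace ℝ (Fin n)}

theorem aux_pos (he : ‖e‖ = 1) (hx : ‖x‖ = 1) : 0 < Real.cosh α + Real.sinh α * ⟪e, x⟫ := by
  have h := abs_real_inner_le_norm e x
  rw [he, hx, mul_one, abs_le] at h
  have h1 : 0 < Real.cosh α + Real.sinh α := by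
    rw [Real.cosh_add_sinh]; exact Real.exp_pos _
  have h2 : 0 < Real.cosh α - Real.sinh α := by
    rw [Real.cosh_sub_sinh]; exact Real.exp_pos _
  rcases le_total 0 (Real.sinh α) with h0 | h0 <;> nlinarith

theorem aux_inner (he : ‖e‖ = 1) (hx : ‖x‖ = 1) (hy : ‖y‖ = 1) :
    (Real.cosh α + Real.sinh α * ⟪e, x⟫) * (Real.cosh α + Real.sinh α * ⟪e, y⟫) *
      (1 - ⟪PhiInf α e x, PhiInf α e y⟫) = 1 - ⟪x, y⟫ := by
  have p1 := (aux_pos α he hx).ne'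
  have p2 := (aux_pos α he hy).ne'
  have hee : ⟪e, e⟫ = 1 := by rw [real_inner_self_eq_norm_sq, he]; norm_num
  have hc := Real.cosh_sq α
  simp only [PhiInf, inner_smul_left, inner_smul_right, inner_add_left, inner_add_right,
    inner_sub_left, inner_sub_right, hee, real_inner_comm e, conj_trivial]
  field_simp
  linear_combination (1 - ⟪e, x⟫ * ⟪e, y⟫) * hc

theorem aux_norm (he : ‖e‖ = 1) (hx : ‖x‖ = 1) : ‖PhiInf α e x‖ = 1 := by
  have h := aux_inner α he hx hx
  have p1 := (aux_pos α he hx).ne'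
  rw [real_inner_self_eq_norm_sq, real_inner_self_eq_norm_sq, hx] at h
  have : 1 - ‖PhiInf α e x‖ ^ 2 = 0 := by
    have h' : (Real.cosh α + Real.sinh α * ⟪e, x⟫) * (Real.cosh α + Real.sinh α * ⟪e, x⟫) *
      (1 - ‖PhiInf α e x‖ ^ 2) = 0 := by rw [h]; norm_num
    simpa [p1] using h'
  have h3 : ‖PhiInf α e x‖ ^ 2 = 1 := by linarith
  exact (pow_eq_one_iff_of_nonneg (norm_nonneg _) two_ne_zero).1 h3

theorem aux_inv (he : ‖e‖ = 1) (hx : ‖x‖ = 1) : PhiInf (-α) e (PhiInf α e x) = x := by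
  have p1 := (aux_pos α he hx).ne'
  have hee : ⟪e, e⟫ = 1 := by rw [real_inner_self_eq_norm_sq, he]; norm_num
  have hc := Real.cosh_sq α
  set L := Real.cosh α + Real.sinh α * ⟪e, x⟫ with hL
  have hu : ⟪e, PhiInf α e x⟫ = (Real.sinh α + Real.cosh α * ⟪e, x⟫) / L := by
    simp only [PhiInf, inner_smul_right, inner_add_right, inner_sub_right, hee, ← hL]
    field_simp
    ring
  have hL2 : Real.cosh α + -Real.sinh α * ((Real.sinh α + Real.cosh α * ⟪e, x⟫) / L) = L⁻¹ := by
    field_simp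
    rw [hL]
    linear_combination hc
  have hs : -Real.sinh α + Real.cosh α * ((Real.sinh α + Real.cosh α * ⟪e, x⟫) / L)
      = ⟪e, x⟫ / L := by
    field_simp
    rw [hL]
    linear_combination ⟪e, x⟫ * hc
  rw [PhiInf, hu, Real.cosh_neg, Real.sinh_neg, hL2, hs, PhiInf, ← hL, inv_inv]
  rw [smul_add, smul_sub, smul_smul, smul_smul, smul_smul, mul_inv_cancel₀ p1,
    mul_div_cancel₀ _ p1, mul_div_cancel₀ _ p1]
  module

theorem aux_dist (he : ‖e‖ = 1) (hx : ‖x‖ = 1) (hy : ‖y‖ = 1) :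
    dist (PhiInf α e x) (PhiInf α e y) ^ 2 =
      (Real.cosh α + Real.sinh α * ⟪e, x⟫)⁻¹ * (Real.cosh α + Real.sinh α * ⟪e, y⟫)⁻¹ *
      dist x y ^ 2 := by
  have p1 := (aux_pos α he hx).ne'
  have p2 := (aux_pos α he hy).ne'
  have h := aux_inner α he hx hy
  rw [dist_eq_norm, dist_eq_norm, norm_sub_sq_real, norm_sub_sq_real, aux_norm α he hx,
    aux_norm α he hy, hx, hy]
  field_simp
  linear_combination 2 * h

theorem aux_meas (e : EuclideanSpace ℝ (Fin n)) : Measurable (PhiInf α e) := by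
  unfold PhiInf
  fun_prop

/-- inverse conformal factor -/
noncomputable def auxG (e x : EuclideanSpace ℝ (Fin n)) : ℝ≥0 :=
  Real.toNNReal ((Real.cosh α + Real.sinh α * ⟪e, x⟫)⁻¹)

theorem auxG_meas (e : EuclideanSpace ℝ (Fin n)) : Measurable (auxG α e) := by
  unfold auxG
  fun_prop

theorem auxG_coe (he : ‖e‖ = 1) (hx : ‖x‖ = 1) :
    (auxG α e x : ℝ) = (Real.cosh α + Real.sinh α * ⟪e, x⟫)⁻¹ :=
  Real.coe_toNNReal _ (inv_nonneg.2 (aux_pos α he hx).le)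

theorem aux_measure (hn : 2 ≤ n) (he : ‖e‖ = 1) :
    ((μH[(n:ℝ) - 1] : Measure (EuclideanSpace ℝ (Fin n))).restrict (Metric.sphere 0 1)).map
        (PhiInf (-α) e) =
      ((μH[(n:ℝ) - 1]).restrict (Metric.sphere 0 1)).withDensity
        (fun x => ((auxG α e x ^ (n - 1) : ℝ≥0) : ℝ≥0∞)) := by
  have hd : (n : ℝ) - 1 = ((n - 1 : ℕ) : ℝ) := by
    rw [Nat.cast_sub (by omega)]; norm_num
  have hd0 : (0 : ℝ) ≤ ((n - 1 : ℕ) : ℝ) := Nat.cast_nonneg _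
  have hm : n - 1 ≠ 0 := by omega
  rw [hd]
  set S : Set (EuclideanSpace ℝ (Fin n)) := Metric.sphere 0 1 with hS
  have hSx : ∀ {x}, x ∈ S ↔ ‖x‖ = 1 := by intro x; simp [hS]
  have hSm : MeasurableSet S := Metric.isClosed_sphere.measurableSet
  have hmap : ∀ A, MeasurableSet A →
      ((μH[((n - 1 : ℕ) : ℝ)] : Measure (EuclideanSpace ℝ (Fin n))).restrict S).map
        (PhiInf (-α) e) A = μH[((n - 1 : ℕ) : ℝ)] (PhiInf α e '' (A ∩ S)) := by
    intro A hA
    rw [Measure.map_apply (aux_meas _ _) hA, Measure.restrict_apply (aux_meas _ _ hA)]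
    congr 1
    ext z
    constructor
    · rintro ⟨h1, h2⟩
      refine ⟨_, ⟨h1, hSx.2 (aux_norm _ he (hSx.1 h2))⟩, ?_⟩
      simpa using aux_inv (-α) he (hSx.1 h2)
    · rintro ⟨w, ⟨h1, h2⟩, rfl⟩
      refine ⟨?_, hSx.2 (aux_norm _ he (hSx.1 h2))⟩
      rw [mem_preimage, aux_inv α he (hSx.1 h2)]
      exact h1
  refine aux_comp_eq _ _ (auxG α e) (auxG_meas α e) _ hm ?_ ?_
  · intro A hA a ha
    rw [hmap A hA, Measure.restrict_apply hA]
    rw [← ENNReal.rpow_natCast]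
    refine LipschitzOnWith.hausdorffMeasure_image_le ?_ hd0
    refine LipschitzOnWith.of_dist_le_mul ?_
    rintro x ⟨hxA, hx⟩ y ⟨hyA, hy⟩
    rw [hSx] at hx hy
    have h := aux_dist α he hx hy
    rw [← auxG_coe α he hx, ← auxG_coe α he hy] at h
    refine (pow_le_pow_iff_left₀ (by positivity) (by positivity) two_ne_zero).1 ?_
    rw [h, mul_pow, sq (a : ℝ)]
    have h1 : (auxG α e x : ℝ) ≤ a := NNReal.coe_le_coe.2 (ha x hxA)
    have h2 : (auxG α e y : ℝ) ≤ a := NNReal.coe_le_coe.2 (ha y hyA)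
    gcongr
  · intro A hA a ha
    rw [hmap A hA, Measure.restrict_apply hA]
    rcases eq_or_ne a 0 with rfl | ha0
    · rw [ENNReal.coe_zero, zero_pow hm, zero_mul]; exact zero_le
    have himg : A ∩ S = PhiInf (-α) e '' (PhiInf α e '' (A ∩ S)) := by
      rw [image_image]
      ext z
      constructor
      · intro hz
        exact ⟨z, hz, aux_inv α he (hSx.1 hz.2)⟩
      · rintro ⟨w, hw, rfl⟩
        beta_reduce
        rw [aux_inv α he (hSx.1 hw.2)]
        exact hw
    have hL : LipschitzOnWith a⁻¹ (PhiInf (-α) e) (PhiInf α e '' (A ∩ S)) := by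
      refine LipschitzOnWith.of_dist_le_mul ?_
      rintro _ ⟨x, ⟨hxA, hx⟩, rfl⟩ _ ⟨y, ⟨hyA, hy⟩, rfl⟩
      rw [hSx] at hx hy
      rw [aux_inv α he hx, aux_inv α he hy, NNReal.coe_inv,
        ← div_eq_inv_mul, le_div_iff₀ (by positivity)]
      have h := aux_dist α he hx hy
      rw [← auxG_coe α he hx, ← auxG_coe α he hy] at h
      refine (pow_le_pow_iff_left₀ (by positivity) (by positivity) two_ne_zero).1 ?_
      rw [h, mul_pow, sq (a : ℝ), mul_comm]
      have h1 : (a : ℝ) ≤ auxG α e x := NNReal.coe_le_coe.2 (ha x hxA)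
      have h2 : (a : ℝ) ≤ auxG α e y := NNReal.coe_le_coe.2 (ha y hyA)
      gcongr
    have h := hL.hausdorffMeasure_image_le hd0
    rw [← himg, ENNReal.rpow_natCast] at h
    refine (mul_le_mul_right h _).trans (le_of_eq ?_)
    rw [← mul_assoc, ← mul_pow, ← ENNReal.coe_mul, mul_inv_cancel₀ ha0]
    simp

end geom

/-- Change-of-variables formula for the conformal transformation `Φ_{α,e}^∞` of the unit
sphere (with `σ` the `(n−1)`-dimensional Hausdorff measure): its Jacobian at `θ̃`
equals `(cosh α + sinh α ⟨e,θ̃⟩)^{−(n−1)}`. -/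
theorem PhiInf_change_of_variables (n : ℕ) (hn : 2 ≤ n) (α : ℝ)
    (e : EuclideanSpace ℝ (Fin n)) (he : e ∈ Metric.sphere (0 : EuclideanSpace ℝ (Fin n)) 1)
    (F : EuclideanSpace ℝ (Fin n) → ℝ)
    (hF : IntegrableOn F (Metric.sphere (0 : EuclideanSpace ℝ (Fin n)) 1)
      (μH[(n:ℝ) - 1])) :
    ∫ θt in Metric.sphere (0 : EuclideanSpace ℝ (Fin n)) 1,
        F (PhiInf α e θt) / (Real.cosh α + Real.sinh α * ⟪e, θt⟫) ^ (n - 1)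
        ∂(μH[(n:ℝ) - 1]) =
      ∫ θ in Metric.sphere (0 : EuclideanSpace ℝ (Fin n)) 1, F θ ∂(μH[(n:ℝ) - 1]) := by
  have he' : ‖e‖ = 1 := by simpa using he
  have hSm : MeasurableSet (Metric.sphere (0 : EuclideanSpace ℝ (Fin n)) 1) :=
    Metric.isClosed_sphere.measurableSet
  have hν := aux_measure α hn he'
  have hmm : (((μH[(n:ℝ) - 1] : Measure (EuclideanSpace ℝ (Fin n))).restrict
      (Metric.sphere 0 1)).map (PhiInf (-α) e)).map (PhiInf α e) =
      (μH[(n:ℝ) - 1]).restrict (Metric.sphere 0 1) := by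
    rw [Measure.map_map (aux_meas _ _) (aux_meas _ _)]
    conv_rhs => rw [← Measure.map_id (μ := (μH[(n:ℝ) - 1]).restrict (Metric.sphere 0 1))]
    refine Measure.map_congr ?_
    filter_upwards [ae_restrict_mem hSm] with x hx
    simpa using aux_inv (-α) he' (x := x) (by simpa using hx)
  rw [hν] at hmm
  conv_rhs => rw [← hmm]
  rw [integral_map (aux_meas _ _).aemeasurable (by rw [hmm]; exact hF.aestronglyMeasurable),
    integral_withDensity_eq_integral_smul ((auxG_meas α e).pow_const _)]
  refine setIntegral_congr_fun hSm fun x hx => ?_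
  have hx' : ‖x‖ = 1 := by simpa using hx
  simp only [NNReal.smul_def, NNReal.coe_pow, auxG_coe α he' hx', smul_eq_mul, inv_pow]
  rw [div_eq_inv_mul]
end

section
/- Let n ≥ 2 be an integer, α ∈ ℝ, e ∈ S^{n−1} ⊂ ℝⁿ, and let Θ : S^{n−1} → ℝ be integrable with respect to σ. Define Θ̃(θ̃) = Θ(Φ_{α,e}^∞(θ̃))·(cosh(α) + sinh(α)·⟨e, θ̃⟩)^{−n}, and set m₀ = ∫_{S^{n−1}} Θ dσ and m_i = ∫_{S^{n−1}} Θ(θ)·θ_i dσ(θ) for i = 1, …, n, where θ_i is the i-th Euclidean coordinate of θ. Then ∫_{S^{n−1}} Θ̃ dσ = cosh(α)·m₀ − sinh(α)·∑_{i=1}^n e_i·m_i. -/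
open scoped RealInnerProductSpace
open MeasureTheory

open scoped ENNReal NNReal

section aux
variable {n : ℕ} (α : ℝ) (e : EuclideanSpace ℝ (Fin n))

noncomputable def lam (x : EuclideanSpace ℝ (Fin n)) : ℝ :=
  Real.cosh α + Real.sinh α * ⟪e, x⟫

lemma lam_cont : Continuous (lam α e) := by unfold lam; fun_prop

lemma phi_meas : Measurable (PhiInf α e) := by unfold PhiInf; fun_prop

variable {α e}

lemma lam_pos (he : ‖e‖ = 1) {x : EuclideanSpace ℝ (Fin n)} (hx : ‖x‖ = 1) : 0 < lam α e x := by
  have h := abs_real_inner_le_norm e x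
  rw [he, hx, one_mul, abs_le] at h
  unfold lam
  have h1 := Real.cosh_sq α
  have h2 := Real.cosh_pos α
  by_contra hc
  push Not at hc
  set u : ℝ := ⟪e, x⟫
  have : Real.cosh α ^ 2 ≤ (Real.sinh α * u) ^ 2 := by nlinarith
  have : (Real.sinh α * u) ^ 2 ≤ Real.sinh α ^ 2 := by
    rw [mul_pow]
    have : u ^ 2 ≤ 1 := by nlinarith
    nlinarith [sq_nonneg (Real.sinh α)]
  linarith

lemma phi_eq (x : EuclideanSpace ℝ (Fin n)) : PhiInf α e x =
    (lam α e x)⁻¹ • (x + (Real.sinh α + (Real.cosh α - 1) * ⟪e, x⟫) • e) := by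
  unfold PhiInf lam
  congr 1
  module

lemma inner_e_phi (he : ‖e‖ = 1) (x : EuclideanSpace ℝ (Fin n)) : ⟪e, PhiInf α e x⟫ =
    (lam α e x)⁻¹ * (Real.sinh α + Real.cosh α * ⟪e, x⟫) := by
  rw [phi_eq, inner_smul_right, inner_add_right, inner_smul_right, real_inner_self_eq_norm_sq, he]
  ring

lemma inner_phi_phi (he : ‖e‖ = 1) (x y : EuclideanSpace ℝ (Fin n))
    (hx : lam α e x ≠ 0) (hy : lam α e y ≠ 0) : ⟪PhiInf α e x, PhiInf α e y⟫ =
    1 - (lam α e x)⁻¹ * (lam α e y)⁻¹ * (1 - ⟪x, y⟫) := by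
  have h1 := Real.cosh_sq α
  rw [phi_eq, phi_eq, inner_smul_right, inner_smul_left, inner_add_right, inner_add_left,
    inner_add_left, inner_smul_right, inner_smul_right, inner_smul_left, inner_smul_left,
    real_inner_self_eq_norm_sq, he, real_inner_comm e x]
  simp only [conj_trivial]
  have key : lam α e x * lam α e y = Real.cosh α ^ 2 + Real.cosh α * Real.sinh α * (⟪e, x⟫ + ⟪e, y⟫)
      + Real.sinh α ^ 2 * ⟪e, x⟫ * ⟪e, y⟫ := by unfold lam; ring
  field_simp
  rw [mul_comm (lam α e y), key]
  linear_combination (⟪e, x⟫ * ⟪e, y⟫ - 1) * h1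

lemma norm_phi (he : ‖e‖ = 1) {x : EuclideanSpace ℝ (Fin n)} (hx : ‖x‖ = 1) :
    ‖PhiInf α e x‖ = 1 := by
  have h := (lam_pos (α := α) he hx).ne'
  have := inner_phi_phi he x x h h
  rw [real_inner_self_eq_norm_sq, real_inner_self_eq_norm_sq, hx] at this
  have h2 := norm_nonneg (PhiInf α e x)
  nlinarith

lemma lam_neg_phi (he : ‖e‖ = 1) {x : EuclideanSpace ℝ (Fin n)} (hx : ‖x‖ = 1) :
    lam (-α) e (PhiInf α e x) = (lam α e x)⁻¹ := by
  have h := (lam_pos (α := α) he hx).ne'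
  have h1 := Real.cosh_sq α
  have hl : lam α e x = Real.cosh α + Real.sinh α * ⟪e, x⟫ := rfl
  rw [lam, inner_e_phi he, Real.cosh_neg, Real.sinh_neg]
  field_simp
  rw [hl]
  linear_combination h1

lemma phi_neg_phi (he : ‖e‖ = 1) {x : EuclideanSpace ℝ (Fin n)} (hx : ‖x‖ = 1) :
    PhiInf (-α) e (PhiInf α e x) = x := by
  have h := (lam_pos (α := α) he hx).ne'
  have h1 := Real.cosh_sq α
  have hl : lam α e x = Real.cosh α + Real.sinh α * ⟪e, x⟫ := rfl
  rw [phi_eq, lam_neg_phi he hx, inner_e_phi he, phi_eq, Real.cosh_neg, Real.sinh_neg, inv_inv,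
    smul_add, smul_smul, smul_smul, mul_inv_cancel₀ h, one_smul, add_assoc, ← add_smul]
  convert add_zero x using 2
  convert zero_smul ℝ e using 2
  field_simp
  rw [hl]
  linear_combination ⟪e, x⟫ * h1

lemma norm_sub_phi (he : ‖e‖ = 1) {x y : EuclideanSpace ℝ (Fin n)} (hx : ‖x‖ = 1) (hy : ‖y‖ = 1) :
    ‖PhiInf α e x - PhiInf α e y‖ ^ 2 = (lam α e x)⁻¹ * (lam α e y)⁻¹ * ‖x - y‖ ^ 2 := by
  rw [norm_sub_sq_real, norm_sub_sq_real, norm_phi he hx, norm_phi he hy, hx, hy,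
    inner_phi_phi he x y (lam_pos he hx).ne' (lam_pos he hy).ne']
  ring

lemma phi_lip (he : ‖e‖ = 1) {A : Set (EuclideanSpace ℝ (Fin n))} {a : ℝ≥0} (ha : 0 < a)
    (hA : ∀ x ∈ A, ‖x‖ = 1 ∧ (a : ℝ) ≤ lam α e x) : LipschitzOnWith a⁻¹ (PhiInf α e) A := by
  apply LipschitzOnWith.of_dist_le_mul
  intro x hx y hy
  obtain ⟨hx, hxa⟩ := hA x hx
  obtain ⟨hy, hya⟩ := hA y hy
  have ha' : (0:ℝ) < a := ha
  rw [dist_eq_norm, dist_eq_norm]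
  apply le_of_sq_le_sq _ (by positivity)
  rw [norm_sub_phi he hx hy, mul_pow, NNReal.coe_inv, sq (a:ℝ)⁻¹]
  have := (lam_pos (α := α) he hy).le
  gcongr

lemma upper_t (he : ‖e‖ = 1) (d : ℕ) {A : Set (EuclideanSpace ℝ (Fin n))} (hAm : MeasurableSet A)
    (hA : ∀ x ∈ A, ‖x‖ = 1) {t : ℝ≥0} (ht : 1 < t) :
    μH[(d:ℝ)] (PhiInf α e '' A) ≤
      (t : ℝ≥0∞) ^ d * ∫⁻ x in A, ((((lam α e x)⁻¹ ^ d).toNNReal : ℝ≥0) : ℝ≥0∞) ∂μH[(d:ℝ)] := by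
  have ht0 : 0 < t := zero_lt_one.trans ht
  let B : ℤ → Set (EuclideanSpace ℝ (Fin n)) :=
    fun k => A ∩ lam α e ⁻¹' (Set.Ico ((t:ℝ) ^ k) ((t:ℝ) ^ (k+1)))
  have hBm : ∀ k, MeasurableSet (B k) := fun k =>
    hAm.inter ((lam_cont α e).measurable measurableSet_Ico)
  have hU : A = ⋃ k, B k := by
    ext x
    simp only [B, Set.mem_iUnion, Set.mem_inter_iff, exists_and_left, Set.mem_preimage]
    refine ⟨fun h => ⟨h, exists_mem_Ico_zpow (lam_pos he (hA x h)) (by exact_mod_cast ht)⟩,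
      fun h => h.1⟩
  have hdisj : Pairwise (Function.onFun Disjoint B) := by
    intro i j hij
    have : Disjoint (Set.Ico ((t:ℝ) ^ i) ((t:ℝ) ^ (i+1))) (Set.Ico ((t:ℝ) ^ j) ((t:ℝ) ^ (j+1))) := by
      have hm : Monotone (fun k : ℤ => (t:ℝ) ^ k) :=
        zpow_right_mono₀ (by exact_mod_cast ht.le)
      exact hm.pairwise_disjoint_on_Ico_succ hij
    exact (this.preimage _).mono Set.inter_subset_right Set.inter_subset_right
  have hk : ∀ k, μH[(d:ℝ)] (PhiInf α e '' B k) ≤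
      (t : ℝ≥0∞) ^ d * ∫⁻ x in B k, ((((lam α e x)⁻¹ ^ d).toNNReal : ℝ≥0) : ℝ≥0∞) ∂μH[(d:ℝ)] := by
    intro k
    have hl : LipschitzOnWith (t ^ k)⁻¹ (PhiInf α e) (B k) := by
      apply phi_lip he (by positivity)
      intro x hx
      refine ⟨hA x hx.1, ?_⟩
      push_cast
      exact hx.2.1
    refine (hl.hausdorffMeasure_image_le (by positivity)).trans ?_
    rw [← lintegral_const_mul' _ _ (by simp), ENNReal.rpow_natCast, ← setLIntegral_const]
    apply setLIntegral_mono' (hBm k)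
    intro x hx
    have hp := lam_pos (α := α) he (hA x hx.1)
    norm_cast
    rw [← NNReal.coe_le_coe]
    push_cast
    rw [Real.coe_toNNReal _ (by positivity), ← mul_pow]
    apply pow_le_pow_left₀ (by positivity)
    have h2 := hx.2.2
    have htr : (0:ℝ) < t := ht0
    have hlt : lam α e x < (t:ℝ) ^ k * t := by rw [← zpow_add_one₀ htr.ne']; exact h2
    rw [← div_eq_mul_inv, inv_eq_one_div, div_le_div_iff₀ (by positivity) hp]
    linarith
  conv_lhs => rw [hU, Set.image_iUnion]
  refine (measure_iUnion_le _).trans ?_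
  conv_rhs => rw [hU, lintegral_iUnion hBm hdisj, ← ENNReal.tsum_mul_left]
  exact ENNReal.tsum_le_tsum hk

lemma upper (he : ‖e‖ = 1) (d : ℕ) {A : Set (EuclideanSpace ℝ (Fin n))} (hAm : MeasurableSet A)
    (hA : ∀ x ∈ A, ‖x‖ = 1) :
    μH[(d:ℝ)] (PhiInf α e '' A) ≤
      ∫⁻ x in A, ((((lam α e x)⁻¹ ^ d).toNNReal : ℝ≥0) : ℝ≥0∞) ∂μH[(d:ℝ)] := by
  set I := ∫⁻ x in A, ((((lam α e x)⁻¹ ^ d).toNNReal : ℝ≥0) : ℝ≥0∞) ∂μH[(d:ℝ)]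
  have hlim : Filter.Tendsto (fun t : ℝ≥0 => ((t ^ d : ℝ≥0) : ℝ≥0∞) * I) (nhdsWithin 1 (Set.Ioi 1))
      (nhds (((1 ^ d : ℝ≥0) : ℝ≥0∞) * I)) := by
    apply ENNReal.Tendsto.mul_const
    · apply ENNReal.tendsto_coe.2
      exact ((continuous_pow d).tendsto (1:ℝ≥0)).mono_left nhdsWithin_le_nhds
    · left; simp
  rw [one_pow, ENNReal.coe_one, one_mul] at hlim
  refine ge_of_tendsto hlim ?_
  filter_upwards [self_mem_nhdsWithin] with t ht
  push_cast
  exact upper_t he d hAm hA ht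

noncomputable def dens (α : ℝ) (e : EuclideanSpace ℝ (Fin n)) (d : ℕ)
    (x : EuclideanSpace ℝ (Fin n)) : ℝ≥0 := ((lam α e x)⁻¹ ^ d).toNNReal

lemma dens_meas (d : ℕ) : Measurable (dens α e d) := by
  have := (lam_cont α e).measurable
  unfold dens; fun_prop

noncomputable def nu (n d : ℕ) : Measure (EuclideanSpace ℝ (Fin n)) :=
  (μH[(d:ℝ)]).restrict (Metric.sphere 0 1)

lemma nu_le (he : ‖e‖ = 1) (d : ℕ) :
    nu n d ≤ ((nu n d).withDensity (fun x => dens α e d x)).map (PhiInf α e) := by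
  rw [Measure.le_iff]
  intro B hB
  have hS : MeasurableSet (Metric.sphere (0 : EuclideanSpace ℝ (Fin n)) 1) :=
    Metric.isClosed_sphere.measurableSet
  have hP := phi_meas α e hB
  rw [Measure.map_apply (phi_meas α e) hB, withDensity_apply _ hP, nu, Measure.restrict_restrict hP,
    Measure.restrict_apply hB]
  refine le_trans (measure_mono ?_) (upper he d (hP.inter hS) (fun x hx => by simpa using hx.2))
  rintro y ⟨hy, hy1⟩
  have hy1 : ‖y‖ = 1 := by simpa using hy1
  have h := phi_neg_phi (α := -α) he hy1
  rw [neg_neg] at h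
  refine ⟨PhiInf (-α) e y, ⟨?_, ?_⟩, h⟩
  · simpa [h] using hy
  · simpa using norm_phi he hy1

lemma nu_eq (he : ‖e‖ = 1) (d : ℕ) :
    nu n d = ((nu n d).withDensity (fun x => dens α e d x)).map (PhiInf α e) := by
  apply le_antisymm (nu_le he d)
  rw [Measure.le_iff]
  intro B hB
  have hS : MeasurableSet (Metric.sphere (0 : EuclideanSpace ℝ (Fin n)) 1) :=
    Metric.isClosed_sphere.measurableSet
  have hP := phi_meas α e hB
  have hae : ∀ᵐ x ∂(nu n d), ‖x‖ = 1 := by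
    unfold nu
    filter_upwards [ae_restrict_mem hS] with x hx
    simpa using hx
  have hdm : Measurable (fun x => (dens α e d x : ℝ≥0∞)) := (dens_meas d).coe_nnreal_ennreal
  have hdm' : Measurable (fun x => (dens (-α) e d x : ℝ≥0∞)) := (dens_meas d).coe_nnreal_ennreal
  rw [Measure.map_apply (phi_meas α e) hB, withDensity_apply _ hP, ← lintegral_indicator hP]
  refine (lintegral_mono' (nu_le (α := -α) he d) le_rfl).trans ?_
  have hc : Measurable (fun x => (PhiInf α e ⁻¹' B).indicator
      (fun x => (dens α e d x : ℝ≥0∞)) (PhiInf (-α) e x)) :=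
    (hdm.indicator hP).comp (phi_meas _ _)
  rw [lintegral_map (hdm.indicator hP) (phi_meas _ _),
    lintegral_withDensity_eq_lintegral_mul _ hdm' hc,
    ← lintegral_indicator_one hB]
  apply lintegral_mono_ae
  filter_upwards [hae] with x hx
  have h := phi_neg_phi (α := -α) he hx
  have hl := lam_neg_phi (α := -α) he hx
  have hp := lam_pos (α := -α) he hx
  rw [neg_neg] at h hl
  by_cases hxB : x ∈ B
  · have hx2 : PhiInf (-α) e x ∈ PhiInf α e ⁻¹' B := by simpa [h] using hxB
    rw [Pi.mul_apply, Set.indicator_of_mem hx2, Set.indicator_of_mem hxB]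
    simp only [dens, hl, inv_inv, Pi.one_apply]
    norm_cast
    rw [← Real.toNNReal_mul (by positivity), ← mul_pow, inv_mul_cancel₀ hp.ne']
    simp
  · have hx2 : PhiInf (-α) e x ∉ PhiInf α e ⁻¹' B := by simpa [h] using hxB
    rw [Pi.mul_apply, Set.indicator_of_notMem hx2]
    simp

end aux

/-- Transformation of the total energy (Section 3.4): with
`Θ̃(θ̃) = Θ(Φ_{α,e}^∞(θ̃)) (cosh α + sinh α ⟨e,θ̃⟩)^{−n}` (formula (9VIII17.C2)),
`m₀ = ∫ Θ dσ` and `mᵢ = ∫ Θ(θ) θᵢ dσ(θ)`, one has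
`∫ Θ̃ dσ = cosh α · m₀ − sinh α · ∑ᵢ eᵢ mᵢ`, where `σ` is the `(n−1)`-dimensional
Hausdorff measure on the unit sphere. -/
theorem energy_transform (n : ℕ) (hn : 2 ≤ n) (α : ℝ)
    (e : EuclideanSpace ℝ (Fin n)) (he : e ∈ Metric.sphere (0 : EuclideanSpace ℝ (Fin n)) 1)
    (Θ : EuclideanSpace ℝ (Fin n) → ℝ)
    (hΘ : IntegrableOn Θ (Metric.sphere (0 : EuclideanSpace ℝ (Fin n)) 1) (μH[(n:ℝ) - 1]))
    (Θt : EuclideanSpace ℝ (Fin n) → ℝ)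
    (hΘt : ∀ θt, Θt θt =
      Θ (PhiInf α e θt) / (Real.cosh α + Real.sinh α * ⟪e, θt⟫) ^ n)
    (m₀ : ℝ)
    (hm₀ : m₀ = ∫ θ in Metric.sphere (0 : EuclideanSpace ℝ (Fin n)) 1, Θ θ ∂(μH[(n:ℝ) - 1]))
    (m : Fin n → ℝ)
    (hm : ∀ i, m i =
      ∫ θ in Metric.sphere (0 : EuclideanSpace ℝ (Fin n)) 1, Θ θ * θ i ∂(μH[(n:ℝ) - 1])) :
    ∫ θt in Metric.sphere (0 : EuclideanSpace ℝ (Fin n)) 1, Θt θt ∂(μH[(n:ℝ) - 1]) =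
      Real.cosh α * m₀ - Real.sinh α * ∑ i, e i * m i := by
  obtain ⟨d, rfl⟩ : ∃ d, n = d + 1 := ⟨n - 1, by omega⟩
  have hd : (((d + 1 : ℕ) : ℝ) - 1) = (d : ℝ) := by push_cast; ring
  simp only [hd] at *
  have he1 : ‖e‖ = 1 := by simpa using he
  have hS : MeasurableSet (Metric.sphere (0 : EuclideanSpace ℝ (Fin (d+1))) 1) :=
    Metric.isClosed_sphere.measurableSet
  change Integrable Θ (nu (d+1) d) at hΘ
  change m₀ = ∫ θ, Θ θ ∂(nu (d+1) d) at hm₀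
  change ∀ i, m i = ∫ θ, Θ θ * θ i ∂(nu (d+1) d) at hm
  change ∫ θ, Θt θ ∂(nu (d+1) d) = _
  have hae : ∀ᵐ x ∂(nu (d+1) d), ‖x‖ = 1 := by
    unfold nu
    filter_upwards [ae_restrict_mem hS] with x hx
    simpa using hx
  have hint : ∀ i, Integrable (fun θ => Θ θ * θ i) (nu (d+1) d) := by
    intro i
    refine hΘ.mul_bdd (c := 1) (by fun_prop) ?_
    filter_upwards [hae] with x hx
    exact (PiLp.norm_apply_le x i).trans hx.le
  have hrhs : Real.cosh α * m₀ - Real.sinh α * ∑ i, e i * m i =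
      ∫ θ, Θ θ * lam (-α) e θ ∂(nu (d+1) d) := by
    simp only [hm, hm₀, ← integral_const_mul]
    rw [← integral_finsetSum _ (fun i _ => (hint i).const_mul _), ← integral_const_mul,
      ← integral_sub (hΘ.const_mul _)
        ((integrable_finsetSum _ (fun i _ => (hint i).const_mul _)).const_mul _)]
    congr 1
    ext θ
    have h1 : ∑ i, e i * (Θ θ * θ i) = Θ θ * ⟪e, θ⟫ := by
      rw [PiLp.inner_apply, Finset.mul_sum]
      apply Finset.sum_congr rfl
      intro i _
      simp
      ring
    rw [h1, lam, Real.cosh_neg, Real.sinh_neg]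
    ring
  have hg : AEStronglyMeasurable (fun θ => Θ θ * lam (-α) e θ) (nu (d+1) d) :=
    hΘ.aestronglyMeasurable.mul (lam_cont _ _).aestronglyMeasurable
  have heq := nu_eq (α := α) he1 d
  have hmap := integral_map (phi_meas α e).aemeasurable (heq ▸ hg)
  rw [← heq, integral_withDensity_eq_integral_smul (dens_meas d)] at hmap
  rw [hrhs, hmap]
  apply integral_congr_ae
  filter_upwards [hae] with x hx
  have hp := lam_pos (α := α) he1 hx
  rw [hΘt, lam_neg_phi he1 hx, NNReal.smul_def, dens, Real.coe_toNNReal _ (by positivity), smul_eq_mul]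
  change _ / (lam α e x) ^ (d+1) = _
  rw [inv_pow]
  field_simp
  ring
end
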